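/- Let 0 < α < 1, h ≥ 0, T > 0, let f : [0,T] × ℝ × ℝ → ℝ be continuous, let g : [0,T] → [−h,T] be continuous with g(t) ≤ t, and assume |f(t,υ₁,ϑ₁) − f(t,υ₂,ϑ₂)| ≤ L(|υ₁ − υ₂| + |ϑ₁ − ϑ₂|) for all υᵢ,ϑᵢ ∈ ℝ, t ∈ [0,T], where L > 0. Let τ > 0 satisfy λ := 2L/τ^α < 1. Suppose ε > 0, ϑ : [−h,T] → ℝ is continuous with |ϑ(t) − ϑ(0) − (1/Γ(α)) ∫₀ᵗ (t−s)^{α−1} f(s, ϑ(s), ϑ(g(s))) ds| ≤ ε T^α / Γ(α+1) for all t ∈ [0,T], and υ : [−h,T] → ℝ is continuous with υ = ϑ on [−h,0] and υ(t) = ϑ(0) + (1/Γ(α)) ∫₀ᵗ (t−s)^{α−1} f(s, υ(s), υ(g(s))) ds for t ∈ [0,T]. Then |ϑ(t) − υ(t)| ≤ ε T^α e^{(h+T)τ} / ((1−λ) Γ(α+1)) for all t ∈ [−h,T]. -/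

import Mathlib

open Real Set

theorem intervalIntegrable_sub_rpow {α : ℝ} (hα : 0 < α) (t : ℝ) :
    IntervalIntegrable (fun s : ℝ => (t - s) ^ (α - 1)) MeasureTheory.volume 0 t := by
  have h := (intervalIntegral.intervalIntegrable_rpow' (a := 0) (b := t)
    (r := α - 1) (by linarith)).comp_sub_left t
  simpa using h.symm

/-- The Riemann-Liouville integral of `exp (τ * s)` is at most `exp (τ * t) / τ ^ α`. -/
theorem integral_sub_rpow_mul_exp_le {α τ t : ℝ} (hα : 0 < α) (hτ : 0 < τ) (ht : 0 ≤ t) :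
    ∫ s in (0:ℝ)..t, (t - s) ^ (α - 1) * Real.exp (τ * s) ≤
      Real.exp (τ * t) * (Real.Gamma α / τ ^ α) := by
  have hsubst : ∫ s in (0:ℝ)..t, (t - s) ^ (α - 1) * Real.exp (τ * s) =
      Real.exp (τ * t) * ∫ u in (0:ℝ)..t, u ^ (α - 1) * Real.exp (-(τ * u)) := by
    have h := intervalIntegral.integral_comp_sub_left (a := 0) (b := t)
      (fun u : ℝ => Real.exp (τ * t) * (u ^ (α - 1) * Real.exp (-(τ * u)))) t
    simp only [sub_self, sub_zero] at h
    rw [← intervalIntegral.integral_const_mul, ← h]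
    refine intervalIntegral.integral_congr fun s _ => ?_
    rw [mul_left_comm, ← Real.exp_add]
    ring_nf
  have hGamma := Real.integral_rpow_mul_exp_neg_mul_Ioi hα hτ
  have hint : MeasureTheory.IntegrableOn
      (fun u : ℝ => u ^ (α - 1) * Real.exp (-(τ * u))) (Set.Ioi 0) := by
    by_contra hnot
    rw [MeasureTheory.integral_undef hnot] at hGamma
    have : 0 < (1 / τ) ^ α * Real.Gamma α := by
      have := Real.Gamma_pos_of_pos hα
      positivity
    linarith
  rw [hsubst]
  gcongr
  calc ∫ u in (0:ℝ)..t, u ^ (α - 1) * Real.exp (-(τ * u))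
      = ∫ u in Set.Ioc 0 t, u ^ (α - 1) * Real.exp (-(τ * u)) :=
        intervalIntegral.integral_of_le ht
    _ ≤ ∫ u in Set.Ioi (0:ℝ), u ^ (α - 1) * Real.exp (-(τ * u)) := by
        refine MeasureTheory.setIntegral_mono_set hint ?_
          Set.Ioc_subset_Ioi_self.eventuallyLE
        filter_upwards [MeasureTheory.ae_restrict_mem measurableSet_Ioi] with u hu
        have : (0:ℝ) < u := hu
        simp only [Pi.zero_apply]
        positivity
    _ = Real.Gamma α / τ ^ α := by
        rw [hGamma, Real.div_rpow zero_le_one hτ.le, Real.one_rpow]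
        ring

/-- If `|φ - ψ| ≤ K * exp (τ * s)` pointwise, then the Riemann-Liouville integrals of `φ` and `ψ`
differ by at most `K * exp (τ * t) / τ ^ α`. -/
theorem abs_sub_rpow_integral_sub_le {α τ t K : ℝ} (hα : 0 < α) (hτ : 0 < τ) (ht : 0 ≤ t)
    (hK : 0 ≤ K) {φ ψ : ℝ → ℝ} (hφ : ContinuousOn φ (Set.Icc 0 t))
    (hψ : ContinuousOn ψ (Set.Icc 0 t))
    (hle : ∀ s ∈ Set.Icc 0 t, |φ s - ψ s| ≤ K * Real.exp (τ * s)) :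
    |(1 / Real.Gamma α) * (∫ s in (0:ℝ)..t, (t - s) ^ (α - 1) * φ s) -
      (1 / Real.Gamma α) * ∫ s in (0:ℝ)..t, (t - s) ^ (α - 1) * ψ s| ≤
      K * Real.exp (τ * t) / τ ^ α := by
  have hker := intervalIntegrable_sub_rpow hα t
  have hΓ := Real.Gamma_pos_of_pos hα
  rw [← Set.uIcc_of_le ht] at hφ hψ
  rw [← mul_sub, ← intervalIntegral.integral_sub (hker.mul_continuousOn hφ)
    (hker.mul_continuousOn hψ), abs_mul, abs_of_pos (one_div_pos.2 hΓ)]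
  have hbound : |∫ s in (0:ℝ)..t, ((t - s) ^ (α - 1) * φ s - (t - s) ^ (α - 1) * ψ s)| ≤
      ∫ s in (0:ℝ)..t, K * ((t - s) ^ (α - 1) * Real.exp (τ * s)) := by
    rw [← Real.norm_eq_abs]
    refine intervalIntegral.norm_integral_le_of_norm_le ht
      (Filter.Eventually.of_forall fun s hs => ?_)
      ((hker.mul_continuousOn (by fun_prop)).const_mul K)
    have hpow : 0 ≤ (t - s) ^ (α - 1) := Real.rpow_nonneg (sub_nonneg.2 hs.2) _
    rw [← mul_sub, Real.norm_eq_abs, abs_mul, abs_of_nonneg hpow, mul_left_comm]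
    exact mul_le_mul_of_nonneg_left (hle s ⟨hs.1.le, hs.2⟩) hpow
  rw [intervalIntegral.integral_const_mul] at hbound
  calc 1 / Real.Gamma α *
        |∫ s in (0:ℝ)..t, ((t - s) ^ (α - 1) * φ s - (t - s) ^ (α - 1) * ψ s)|
      ≤ 1 / Real.Gamma α * (K * (Real.exp (τ * t) * (Real.Gamma α / τ ^ α))) := by
        gcongr
        exact hbound.trans
          (mul_le_mul_of_nonneg_left (integral_sub_rpow_mul_exp_le hα hτ ht) hK)
    _ = K * Real.exp (τ * t) / τ ^ α := by
        field_simp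

theorem hyers_ulam_explicit_constant
    (α h T L τ ε : ℝ) (hα0 : 0 < α) (hα1 : α < 1) (hh : 0 ≤ h) (hT : 0 < T)
    (hL : 0 < L) (hτ : 0 < τ) (hlam : 2 * L / τ ^ α < 1) (hε : 0 < ε)
    (f : ℝ → ℝ → ℝ → ℝ) (g : ℝ → ℝ)
    (hf : ContinuousOn (fun p : ℝ × ℝ × ℝ => f p.1 p.2.1 p.2.2)
      (Set.Icc 0 T ×ˢ (Set.univ : Set (ℝ × ℝ))))
    (hg : ContinuousOn g (Set.Icc 0 T))
    (hgmem : ∀ t ∈ Set.Icc (0:ℝ) T, g t ∈ Set.Icc (-h) T)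
    (hgle : ∀ t ∈ Set.Icc (0:ℝ) T, g t ≤ t)
    (hLip : ∀ t ∈ Set.Icc (0:ℝ) T, ∀ υ₁ υ₂ ϑ₁ ϑ₂ : ℝ,
      |f t υ₁ ϑ₁ - f t υ₂ ϑ₂| ≤ L * (|υ₁ - υ₂| + |ϑ₁ - ϑ₂|))
    (ϑ υ : ℝ → ℝ)
    (hϑ : ContinuousOn ϑ (Set.Icc (-h) T))
    (hϑapprox : ∀ t ∈ Set.Icc (0:ℝ) T,
      |ϑ t - ϑ 0 - (1 / Real.Gamma α) *
        ∫ s in (0:ℝ)..t, (t - s) ^ (α - 1) * f s (ϑ s) (ϑ (g s))| ≤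
        ε * T ^ α / Real.Gamma (α + 1))
    (hυ : ContinuousOn υ (Set.Icc (-h) T))
    (hinit : Set.EqOn υ ϑ (Set.Icc (-h) 0))
    (hsol : ∀ t ∈ Set.Icc (0:ℝ) T, υ t = ϑ 0 +
      (1 / Real.Gamma α) * ∫ s in (0:ℝ)..t, (t - s) ^ (α - 1) * f s (υ s) (υ (g s))) :
    ∀ t ∈ Set.Icc (-h) T,
      |ϑ t - υ t| ≤ ε * T ^ α * Real.exp ((h + T) * τ) /
        ((1 - 2 * L / τ ^ α) * Real.Gamma (α + 1)) := by
  set C : ℝ := ε * T ^ α / Real.Gamma (α + 1) with hC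
  have hΓ : 0 < Real.Gamma (α + 1) := Real.Gamma_pos_of_pos (by linarith)
  have hC0 : 0 < C := by positivity
  have hlam' : 0 < 1 - 2 * L / τ ^ α := by linarith
  have hcomp : ∀ {w : ℝ → ℝ}, ContinuousOn w (Set.Icc (-h) T) →
      ContinuousOn (fun s => f s (w s) (w (g s))) (Set.Icc 0 T) := fun {w} hw =>
    hf.comp (f := fun s => (s, w s, w (g s)))
      (continuousOn_id.prodMk ((hw.mono (Set.Icc_subset_Icc_left (by linarith))).prodMk
        (hw.comp hg hgmem)))
      fun s hs => ⟨hs, Set.mem_univ _⟩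
  obtain ⟨t₀, ht₀, hmax⟩ := isCompact_Icc.exists_isMaxOn
    (Set.nonempty_Icc.2 (by linarith : -h ≤ T))
    (show ContinuousOn (fun t => |ϑ t - υ t| * Real.exp (-(τ * t))) (Set.Icc (-h) T) by fun_prop)
  set M : ℝ := |ϑ t₀ - υ t₀| * Real.exp (-(τ * t₀)) with hM
  have hM0 : 0 ≤ M := by positivity
  have hdist : ∀ t ∈ Set.Icc (-h) T, |ϑ t - υ t| ≤ M * Real.exp (τ * t) := fun t ht => by
    have hle : |ϑ t - υ t| * Real.exp (-(τ * t)) ≤ M := hmax ht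
    rwa [Real.exp_neg, ← div_eq_mul_inv, div_le_iff₀ (Real.exp_pos _)] at hle
  have hMC : M ≤ C / (1 - 2 * L / τ ^ α) := by
    rcases le_total t₀ 0 with hneg | hpos
    · have : M = 0 := by rw [hM, hinit ⟨ht₀.1, hneg⟩]; simp
      rw [this]
      positivity
    have ht₀' : t₀ ∈ Set.Icc 0 T := ⟨hpos, ht₀.2⟩
    have hsub : Set.Icc 0 t₀ ⊆ Set.Icc 0 T := Set.Icc_subset_Icc_right ht₀.2
    have hint := abs_sub_rpow_integral_sub_le hα0 hτ hpos (K := 2 * L * M) (by positivity)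
      ((hcomp hϑ).mono hsub) ((hcomp hυ).mono hsub) fun s hs => by
        have hs' := hsub hs
        have hdg : |ϑ (g s) - υ (g s)| ≤ M * Real.exp (τ * s) :=
          (hdist _ (hgmem s hs')).trans (by gcongr; exact hgle s hs')
        calc |f s (ϑ s) (ϑ (g s)) - f s (υ s) (υ (g s))|
            ≤ L * (|ϑ s - υ s| + |ϑ (g s) - υ (g s)|) := hLip s hs' _ _ _ _
          _ ≤ L * (M * Real.exp (τ * s) + M * Real.exp (τ * s)) := by
              gcongr
              exact hdist s ⟨by linarith [hs'.1], hs'.2⟩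
          _ = 2 * L * M * Real.exp (τ * s) := by ring
    have hdiff : |ϑ t₀ - υ t₀| ≤ C + 2 * L * M * Real.exp (τ * t₀) / τ ^ α := by
      rw [hsol t₀ ht₀']
      refine le_of_eq_of_le (congrArg abs ?_)
        ((abs_add_le _ _).trans (add_le_add (hϑapprox t₀ ht₀') hint))
      ring
    have hCexp : C ≤ C * Real.exp (τ * t₀) :=
      le_mul_of_one_le_right hC0.le (Real.one_le_exp (by positivity))
    have hMle : M ≤ C + 2 * L / τ ^ α * M := by
      calc M ≤ (C * Real.exp (τ * t₀) + 2 * L * M * Real.exp (τ * t₀) / τ ^ α) *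
            Real.exp (-(τ * t₀)) := by
            rw [hM]
            gcongr
            linarith
        _ = C + 2 * L / τ ^ α * M := by
            rw [Real.exp_neg]
            field_simp
    rw [le_div_iff₀ hlam']
    linarith
  intro t ht
  calc |ϑ t - υ t| ≤ M * Real.exp (τ * t) := hdist t ht
    _ ≤ C / (1 - 2 * L / τ ^ α) * Real.exp ((h + T) * τ) := by
        refine mul_le_mul hMC (Real.exp_le_exp.2 ?_) (Real.exp_pos _).le (by positivity)
        nlinarith [ht.2]
    _ = ε * T ^ α * Real.exp ((h + T) * τ) /
        ((1 - 2 * L / τ ^ α) * Real.Gamma (α + 1)) := by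
        rw [hC]
        field_simp
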